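/- arXiv:1211.1343 — 2 statements merged into one kernel-verified Lean document; each statement's English description precedes it below -/
import Mathlib

section
/- For every s ∈ [0,1], ∫₀¹ ∫_u¹ 2·[ (1−(v−u))^β · h(K₀(s;u,v)) + (v−u)^β · h(K₁(s;u,v)) ] dv du = h(s), where h(s) = (s(1−s))^β. (Equivalently: if (U,V) is a random vector with density 2·1{0 ≤ u ≤ v ≤ 1} on [0,1]², then E[(1−(V−U))^β·h(K₀(s;U,V)) + (V−U)^β·h(K₁(s;U,V))] = h(s), so that the recursively defined processes Z_n(s) form a martingale for each fixed s.) -/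
noncomputable section

/-- The exponent `β = (√17 − 3)/2`. -/
def betaExp : ℝ := (Real.sqrt 17 - 3) / 2

/-- `K₀(s;u,v)` from the recursive triangulation of the disk. -/
def K0 (s u v : ℝ) : ℝ :=
  if s < u then s / (1 - (v - u))
  else if s < v then u / (1 - (v - u))
  else (s - (v - u)) / (1 - (v - u))

/-- `K₁(s;u,v)` from the recursive triangulation of the disk. -/
def K1 (s u v : ℝ) : ℝ :=
  if u ≤ s ∧ s < v then (s - u) / (v - u) else 0

/-- `h(s) = (s(1−s))^β`. -/
def hfun (s : ℝ) : ℝ := (s * (1 - s)) ^ betaExp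

open MeasureTheory Set Filter Topology

lemma be_pos : 0 < betaExp := by
  unfold betaExp
  have : (3:ℝ) < Real.sqrt 17 := by
    rw [Real.lt_sqrt] <;> norm_num
  linarith

lemma be_eq : (betaExp + 1) * (betaExp + 2) = 4 := by
  unfold betaExp
  have := Real.sq_sqrt (show (0:ℝ) ≤ 17 by norm_num)
  nlinarith

def fa (a w : ℝ) : ℝ := (a * (w - a) / max w a) ^ betaExp

lemma fa_cont {a : ℝ} (ha : 0 < a) : Continuous (fa a) := by
  unfold fa
  refine Continuous.rpow_const ?_ (fun x => Or.inr be_pos.le)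
  refine Continuous.div (by fun_prop) (by fun_prop) (fun x => ?_)
  exact (lt_of_lt_of_le ha (le_max_right _ _)).ne'

lemma fa_eq {a w : ℝ} (h : a ≤ w) : fa a w = (a * (w - a) / w) ^ betaExp := by
  unfold fa; rw [max_eq_left h]

def Tf (a u : ℝ) : ℝ := ∫ w in u..1, fa a w

lemma Tf_deriv {a : ℝ} (ha : 0 < a) (u : ℝ) : HasDerivAt (Tf a) (-fa a u) u := by
  unfold Tf
  exact intervalIntegral.integral_hasDerivAt_left ((fa_cont ha).intervalIntegrable _ _)
    ((fa_cont ha).stronglyMeasurableAtFilter _ _) (fa_cont ha).continuousAt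

lemma Tf_cont {a : ℝ} (ha : 0 < a) : Continuous (Tf a) :=
  continuous_iff_continuousAt.2 fun u => (Tf_deriv ha u).continuousAt

lemma fa_deriv {a u : ℝ} (ha : 0 < a) (hu : a < u) :
    HasDerivAt (fun w => w * (w - a) * fa a w) ((2 * u - a + a * betaExp) * fa a u) u := by
  have hu0 : 0 < u := ha.trans hu
  have hua : 0 < u - a := sub_pos.2 hu
  have hb : 0 < a * (u - a) / u := by positivity
  have h1 : HasDerivAt (fun w => a * (w - a) / w) ((a * 1 * u - a * (u - a) * 1) / u ^ 2) u :=
    (((hasDerivAt_id u).sub_const a).const_mul a).div (hasDerivAt_id u) hu0.ne'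
  have h2 := h1.rpow_const (p := betaExp) (Or.inl hb.ne')
  have h3 : HasDerivAt (fa a) _ u := h2.congr_of_eventuallyEq
    ((eventually_gt_nhds hu).mono fun w hw => fa_eq hw.le)
  have h4 : HasDerivAt (fun w => w * (w - a)) (1 * (u - a) + u * 1) u :=
    (hasDerivAt_id u).mul ((hasDerivAt_id u).sub_const a)
  refine (h4.mul h3).congr_deriv ?_
  rw [fa_eq hu.le, Real.rpow_sub_one hb.ne']
  field_simp
  ring

lemma L2 {a : ℝ} (ha : 0 < a) (ha1 : a < 1) :
    2 * (∫ u in a..1, Tf a u) + (betaExp + 1) * a * (∫ w in a..1, fa a w)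
      = (1 - a) * (a * (1 - a)) ^ betaExp := by
  have hI : ∀ u, HasDerivAt (fun u => ∫ w in a..u, fa a w) (fa a u) u := fun u =>
    intervalIntegral.integral_hasDerivAt_right ((fa_cont ha).intervalIntegrable _ _)
    ((fa_cont ha).stronglyMeasurableAtFilter _ _) (fa_cont ha).continuousAt
  have hIc : Continuous (fun u => ∫ w in a..u, fa a w) :=
    continuous_iff_continuousAt.2 fun u => (hI u).continuousAt
  have hT := Tf_cont ha
  have hf := fa_cont ha
  have key := intervalIntegral.integral_eq_sub_of_hasDerivAt_of_le (a := a) (b := 1)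
    (f := fun u => 2 * (u - a) * Tf a u + u * (u - a) * fa a u
      - (betaExp + 1) * a * ∫ w in a..u, fa a w) (f' := fun u => 2 * Tf a u) ha1.le
    (by fun_prop) (by
      intro u hu
      have h1 : HasDerivAt (fun u => 2 * (u - a)) (2 * 1) u :=
        ((hasDerivAt_id u).sub_const a).const_mul 2
      refine (((h1.mul (Tf_deriv ha u)).add (fa_deriv ha hu.1)).sub
        ((hI u).const_mul ((betaExp + 1) * a))).congr_deriv ?_
      ring) ((by fun_prop : Continuous fun u => 2 * Tf a u).intervalIntegrable _ _)
  rw [intervalIntegral.integral_const_mul] at key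
  rw [key]
  simp only [sub_self, intervalIntegral.integral_same]
  have : Tf a 1 = 0 := by simp [Tf]
  rw [this, fa_eq ha1.le]
  simp only [div_one]
  ring

def ph (t : ℝ) : ℝ := (max t 0 / (1 + max t 0)) ^ betaExp
lemma ph_cont : Continuous ph := by
  unfold ph
  refine Continuous.rpow_const ?_ (fun x => Or.inr be_pos.le)
  refine Continuous.div (by fun_prop) (by fun_prop) (fun x => ?_)
  have := le_max_right x 0
  positivity

def Ph (z : ℝ) : ℝ := ∫ t in (0:ℝ)..z, ph t

lemma Ph_deriv (z : ℝ) : HasDerivAt Ph (ph z) z :=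
  intervalIntegral.integral_hasDerivAt_right (ph_cont.intervalIntegrable _ _)
    (ph_cont.stronglyMeasurableAtFilter _ _) ph_cont.continuousAt
lemma Ph_cont : Continuous Ph :=
  continuous_iff_continuousAt.2 fun u => (Ph_deriv u).continuousAt

lemma ph_nonneg (t : ℝ) : 0 ≤ ph t := by
  unfold ph
  have := le_max_right t 0
  positivity
lemma ph_le (t : ℝ) : ph t ≤ 1 := by
  unfold ph
  have := le_max_right t 0
  apply Real.rpow_le_one (by positivity) _ be_pos.le
  rw [div_le_one (by positivity)]; linarith

lemma Ph_nonneg {z : ℝ} (hz : 0 ≤ z) : 0 ≤ Ph z :=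
  intervalIntegral.integral_nonneg hz fun t _ => ph_nonneg t
lemma Ph_le {z : ℝ} (hz : 0 ≤ z) : Ph z ≤ z := by
  have := intervalIntegral.integral_mono_on (a := 0) (b := z) (μ := volume) hz (ph_cont.intervalIntegrable _ _)
    ((continuous_const (y := (1:ℝ))).intervalIntegrable _ _) (fun t _ => ph_le t)
  simpa [Ph] using this

def Q (a c : ℝ) : ℝ := ∫ y in (0:ℝ)..c, (a * y / (a + y)) ^ betaExp

lemma Q_zero (c : ℝ) : Q 0 c = 0 := by
  simp [Q, Real.zero_rpow be_pos.ne']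

lemma Q_eq {x c : ℝ} (hx : 0 < x) (hc : 0 ≤ c) : Q x c = x ^ (betaExp + 1) * Ph (c / x) := by
  have h : Q x c = ∫ y in (0:ℝ)..c, x ^ betaExp * ph (y / x) := by
    unfold Q
    apply intervalIntegral.integral_congr
    intro y hy
    rw [uIcc_of_le hc] at hy
    have hy0 := hy.1
    have : 0 ≤ y / x := by positivity
    simp only [ph]
    rw [max_eq_left this, ← Real.mul_rpow hx.le (by positivity)]
    congr 1
    field_simp
  rw [h, intervalIntegral.integral_const_mul, intervalIntegral.integral_comp_div _ hx.ne',
    Real.rpow_add hx, Real.rpow_one]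
  simp [Ph, mul_assoc]

lemma Q_cont {c : ℝ} (hc : 0 ≤ c) (a : ℝ) : ContinuousOn (fun x => Q x c) (Icc 0 a) := by
  intro x hx
  rcases hx.1.eq_or_lt with h | h
  · subst h
    unfold ContinuousWithinAt
    simp only [Q_zero]
    have hlim : Tendsto (fun x : ℝ => c * x ^ betaExp) (𝓝[Icc 0 a] 0) (𝓝 0) := by
      have : Continuous (fun x : ℝ => c * x ^ betaExp) :=
        continuous_const.mul (continuous_id.rpow_const fun _ => Or.inr be_pos.le)
      have h := this.tendsto 0
      simp only [Real.zero_rpow be_pos.ne', mul_zero] at h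
      exact h.mono_left nhdsWithin_le_nhds
    refine tendsto_of_tendsto_of_tendsto_of_le_of_le' tendsto_const_nhds hlim ?_ ?_
    · filter_upwards [self_mem_nhdsWithin] with y hy
      rcases hy.1.eq_or_lt with h | h
      · rw [← h, Q_zero]
      · rw [Q_eq h hc]
        have := Ph_nonneg (z := c / y) (by positivity)
        positivity
    · filter_upwards [self_mem_nhdsWithin] with y hy
      rcases hy.1.eq_or_lt with h | h
      · rw [← h, Q_zero]; simp [Real.zero_rpow be_pos.ne']
      · rw [Q_eq h hc]
        have := Ph_le (z := c / y) (by positivity)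
        calc _ ≤ y ^ (betaExp + 1) * (c / y) := by gcongr
          _ = _ := by
            rw [Real.rpow_add h, Real.rpow_one]; field_simp
  · apply ContinuousAt.continuousWithinAt
    have : ContinuousAt (fun x => x ^ (betaExp + 1) * Ph (c / x)) x := by
      refine ContinuousAt.mul (Real.continuousAt_rpow_const _ _ (Or.inl h.ne')) ?_
      exact ContinuousAt.comp (f := fun x => c / x) Ph_cont.continuousAt
        (continuousAt_const.div continuousAt_id h.ne')
    refine this.congr ((eventually_gt_nhds h).mono fun w hw => (Q_eq hw hc).symm)

lemma Q_int {c a : ℝ} (hc : 0 ≤ c) (ha : 0 ≤ a) :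
    IntervalIntegrable (fun x => Q x c) volume 0 a :=
  ContinuousOn.intervalIntegrable_of_Icc ha (Q_cont hc a)

lemma L1 {a c : ℝ} (ha : 0 < a) (hc : 0 < c) :
    (betaExp + 2) * (∫ x in (0:ℝ)..a, Q x c) = a * Q a c + c * Q c a := by
  have hk : IntervalIntegrable (fun x => (c * x / (c + x)) ^ betaExp) volume 0 a := by
    apply ContinuousOn.intervalIntegrable_of_Icc ha.le
    refine ContinuousOn.rpow_const ?_ (fun x _ => Or.inr be_pos.le)
    refine ContinuousOn.div (by fun_prop) (by fun_prop) (fun x hx => ?_)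
    have := hx.1
    positivity
  have key := intervalIntegral.integral_eq_sub_of_hasDerivAt_of_le (a := 0) (b := a)
    (f := fun x => x * Q x c)
    (f' := fun x => (betaExp + 2) * Q x c - c * (c * x / (c + x)) ^ betaExp) ha.le
    (continuousOn_id.mul (Q_cont hc.le a)) (by
      intro x hx
      have hx0 := hx.1
      have h1 : HasDerivAt (fun x => c / x) _ x :=
        (hasDerivAt_const x c).div (hasDerivAt_id x) hx0.ne'
      have h2 : HasDerivAt (fun x => Ph (c / x)) _ x := (Ph_deriv (c / x)).comp x h1
      have h3 : HasDerivAt (fun x : ℝ => x ^ (betaExp + 2)) _ x :=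
        Real.hasDerivAt_rpow_const (Or.inl hx0.ne')
      have h4 := h3.mul h2
      refine (h4.congr_of_eventuallyEq ?_).congr_deriv ?_
      · filter_upwards [eventually_gt_nhds hx0] with y hy
        simp only [Pi.mul_apply]
        rw [Q_eq hy hc.le, show betaExp + 2 = betaExp + 1 + 1 by ring, Real.rpow_add_one hy.ne' (betaExp + 1)]
        ring
      · have e : (c * x / (c + x)) ^ betaExp = x ^ betaExp * ph (c / x) := by
          have : 0 ≤ c / x := by positivity
          rw [ph, max_eq_left this, ← Real.mul_rpow hx0.le (by positivity)]
          congr 1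
          field_simp
          ring
        rw [e, Q_eq hx0 hc.le, show betaExp + 2 - 1 = betaExp + 1 by ring,
          show betaExp + 2 = betaExp + 1 + 1 by ring, Real.rpow_add_one hx0.ne' (betaExp + 1),
          Real.rpow_add_one hx0.ne']
        field_simp
        ring) (((Q_int hc.le ha.le).const_mul _).sub (hk.const_mul _))
  rw [intervalIntegral.integral_sub ((Q_int hc.le ha.le).const_mul _) (hk.const_mul _),
    intervalIntegral.integral_const_mul, intervalIntegral.integral_const_mul] at key
  have : Q c a = ∫ x in (0:ℝ)..a, (c * x / (c + x)) ^ betaExp := rfl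
  rw [this]
  linarith

lemma Q_fa {a : ℝ} (ha1 : a ≤ 1) : (∫ w in a..1, fa a w) = Q a (1 - a) := by
  unfold Q
  have := intervalIntegral.integral_comp_add_left (a := 0) (b := 1 - a) (fun w => fa a w) a
  rw [add_zero, add_sub_cancel] at this
  rw [← this]
  apply intervalIntegral.integral_congr
  intro y hy
  rw [uIcc_of_le (by linarith)] at hy
  simp only
  rw [fa_eq (by linarith [hy.1])]
  congr 2
  ring

def F (s u v : ℝ) : ℝ := 2 * ((1 - (v - u)) ^ betaExp * hfun (K0 s u v)
              + (v - u) ^ betaExp * hfun (K1 s u v))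

lemma hfun0 : hfun 0 = 0 := by simp [hfun, Real.zero_rpow be_pos.ne']
lemma hfun1 : hfun 1 = 0 := by simp [hfun, Real.zero_rpow be_pos.ne']

lemma scale {w p q : ℝ} (hw : 0 < w) (hp : 0 ≤ p) (hq : 0 ≤ q) (h : p + q = w) :
    w ^ betaExp * hfun (p / w) = (p * q / w) ^ betaExp := by
  have e : 1 - p / w = q / w := by field_simp; linarith
  unfold hfun
  rw [e, ← Real.mul_rpow hw.le (by positivity)]
  congr 1
  field_simp

lemma FA {s u v : ℝ} (hs : 0 < s) (h1 : s < u) (h2 : u < v) (h3 : v ≤ 1) :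
    F s u v = 2 * fa s (1 + u - v) := by
  unfold F K0 K1
  rw [if_pos h1, if_neg (by rintro ⟨h, -⟩; linarith), hfun0,
    scale (q := 1 - (v - u) - s) (by linarith) hs.le (by linarith) (by ring),
    fa_eq (by linarith), mul_zero, add_zero]
  congr 3 <;> ring

lemma FC {s u v : ℝ} (hs : s < 1) (h0 : 0 < u) (h1 : u < v) (h2 : v < s) :
    F s u v = 2 * fa (1 - s) (1 + u - v) := by
  unfold F K0 K1
  rw [if_neg (by linarith), if_neg (by linarith), if_neg (by rintro ⟨-, h⟩; linarith), hfun0,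
    scale (q := 1 - s) (by linarith) (by linarith) (by linarith) (by ring),
    fa_eq (by linarith), mul_zero, add_zero]
  congr 3 <;> ring

lemma FB {s u v : ℝ} (h0 : 0 < u) (h1 : u < s) (h2 : s < v) (h3 : v ≤ 1) :
    F s u v = 2 * ((u * (1 - v) / (u + (1 - v))) ^ betaExp
      + ((s - u) * (v - s) / (s - u + (v - s))) ^ betaExp) := by
  unfold F K0 K1
  rw [if_neg (by linarith), if_pos h2, if_pos ⟨h1.le, h2⟩,
    scale (q := 1 - v) (by linarith) (by linarith) (by linarith) (by ring),
    scale (q := v - s) (by linarith) (by linarith) (by linarith) (by ring)]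
  congr 4 <;> ring

lemma shift (a u x y : ℝ) : (∫ v in x..y, 2 * fa a (1 + u - v))
    = 2 * ∫ w in (1 + u - y)..(1 + u - x), fa a w := by
  rw [intervalIntegral.integral_const_mul, intervalIntegral.integral_comp_sub_left (fun w => fa a w)]

lemma congr_oo {f g : ℝ → ℝ} {a b : ℝ} (hab : a ≤ b) (h : ∀ x, a < x → x < b → f x = g x) :
    (∫ x in a..b, f x) = ∫ x in a..b, g x := by
  apply intervalIntegral.integral_congr_ae_restrict
  rw [uIoc_of_le hab, ← restrict_Ioo_eq_restrict_Ioc]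
  exact (ae_restrict_mem measurableSet_Ioo).mono fun x hx => h x hx.1 hx.2

lemma int_oo {f g : ℝ → ℝ} {a b : ℝ} (hab : a ≤ b) (h : ∀ x, a < x → x < b → f x = g x)
    (hg : IntervalIntegrable g volume a b) : IntervalIntegrable f volume a b := by
  apply hg.congr_ae
  rw [uIoc_of_le hab, ← restrict_Ioo_eq_restrict_Ioc]
  exact (ae_restrict_mem measurableSet_Ioo).mono fun x hx => (h x hx.1 hx.2).symm

lemma inA {s u : ℝ} (hs : 0 < s) (h1 : s < u) (h2 : u < 1) :
    (∫ v in u..1, F s u v) = 2 * Tf s u := by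
  rw [congr_oo h2.le fun v hv hv' => FA hs h1 hv hv'.le, shift]
  simp [Tf]

lemma inB {s u : ℝ} (hs : s < 1) (h0 : 0 < u) (h1 : u < s) :
    (∫ v in u..1, F s u v) = 2 * Tf (1 - s) (1 - s + u) + 2 * (Q u (1 - s) + Q (s - u) (1 - s)) := by
  have c1 : IntervalIntegrable (fun v => 2 * fa (1 - s) (1 + u - v)) volume u s := by
    have := fa_cont (sub_pos.2 hs)
    exact (by fun_prop : Continuous _).intervalIntegrable _ _
  have c2 : IntervalIntegrable (fun v => (u * (1 - v) / (u + (1 - v))) ^ betaExp) volume s 1 := by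
    apply ContinuousOn.intervalIntegrable_of_Icc hs.le
    refine ContinuousOn.rpow_const ?_ (fun x _ => Or.inr be_pos.le)
    refine ContinuousOn.div (by fun_prop) (by fun_prop) (fun x hx => ?_)
    linarith [hx.2]
  have c3 : IntervalIntegrable (fun v => ((s - u) * (v - s) / (s - u + (v - s))) ^ betaExp)
      volume s 1 := by
    apply ContinuousOn.intervalIntegrable_of_Icc hs.le
    refine ContinuousOn.rpow_const ?_ (fun x _ => Or.inr be_pos.le)
    refine ContinuousOn.div (by fun_prop) (by fun_prop) (fun x hx => ?_)
    linarith [hx.1]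
  have e1 : ∀ v, u < v → v < s → F s u v = _ := fun v hv hv' => FC hs h0 hv hv'
  have e2 : ∀ v, s < v → v < 1 → F s u v = _ := fun v hv hv' => FB h0 h1 hv hv'.le
  rw [← intervalIntegral.integral_add_adjacent_intervals (int_oo h1.le e1 c1)
    (int_oo hs.le e2 ((c2.add c3).const_mul 2)), congr_oo h1.le e1, congr_oo hs.le e2, shift,
    intervalIntegral.integral_const_mul, intervalIntegral.integral_add c2 c3,
    intervalIntegral.integral_comp_sub_left (fun y => (u * y / (u + y)) ^ betaExp),
    intervalIntegral.integral_comp_sub_right (fun y => ((s - u) * y / (s - u + y)) ^ betaExp)]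
  simp only [Tf, Q, sub_self]
  rw [show 1 + u - s = 1 - s + u by ring, show 1 + u - u = 1 by ring]

lemma main_mid {s : ℝ} (h0 : 0 < s) (h1 : s < 1) :
    (∫ u in (0:ℝ)..1, ∫ v in u..(1:ℝ), F s u v) = hfun s := by
  have hc : 0 < 1 - s := sub_pos.2 h1
  have e1 : ∀ u, 0 < u → u < s → (∫ v in u..1, F s u v) = _ := fun u hu hu' => inB h1 hu hu'
  have e2 : ∀ u, s < u → u < 1 → (∫ v in u..1, F s u v) = _ := fun u hu hu' => inA h0 hu hu'
  have hT := Tf_cont h0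
  have hT' := Tf_cont hc
  have c1 : IntervalIntegrable (fun u => 2 * Tf (1 - s) (1 - s + u)) volume 0 s :=
    (by fun_prop : Continuous _).intervalIntegrable _ _
  have c2 := Q_int hc.le h0.le
  have c3 : IntervalIntegrable (fun u => Q (s - u) (1 - s)) volume 0 s := by
    have := (c2.comp_sub_left s).symm
    simpa using this
  have c4 : IntervalIntegrable (fun u => 2 * Tf s u) volume s 1 :=
    (by fun_prop : Continuous _).intervalIntegrable _ _
  rw [← intervalIntegral.integral_add_adjacent_intervals
    (int_oo h0.le e1 (c1.add ((c2.add c3).const_mul 2)))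
    (int_oo h1.le e2 c4), congr_oo h0.le e1, congr_oo h1.le e2,
    intervalIntegral.integral_add c1 ((c2.add c3).const_mul 2),
    intervalIntegral.integral_const_mul, intervalIntegral.integral_const_mul,
    intervalIntegral.integral_const_mul,
    intervalIntegral.integral_add c2 c3,
    intervalIntegral.integral_comp_sub_left (fun y => Q y (1 - s)),
    intervalIntegral.integral_comp_add_left (fun y => Tf (1 - s) y)]
  have l1 := L1 h0 hc
  have l2 := L2 h0 h1
  have l3 := L2 hc (by linarith)
  rw [Q_fa h1.le] at l2
  rw [Q_fa (by linarith)] at l3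
  simp only [sub_sub_cancel, sub_self, sub_zero, add_zero, sub_add_cancel] at *
  rw [mul_comm (1 - s) s] at l3
  unfold hfun
  have hb := be_eq
  have hp := be_pos
  have l4 : 4 * (∫ x in (0:ℝ)..s, Q x (1 - s))
      = (betaExp + 1) * (s * Q s (1 - s) + (1 - s) * Q (1 - s) s) := by
    rw [← l1, ← mul_assoc, hb]
  linarith

/-- the mean harmonic identity
`∫₀¹∫ᵤ¹ 2[(1−(v−u))^β h(K₀(s;u,v)) + (v−u)^β h(K₁(s;u,v))] dv du = h(s)`,
i.e. `E[(1−(V−U))^β h(K₀(s;U,V)) + (V−U)^β h(K₁(s;U,V))] = h(s)` for `(U,V)`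
with density `2·1{0 ≤ u ≤ v ≤ 1}`. -/
theorem stmt_3 :
    ∀ s ∈ Set.Icc (0:ℝ) 1,
      (∫ u in (0:ℝ)..1, ∫ v in u..(1:ℝ),
          2 * ((1 - (v - u)) ^ betaExp * hfun (K0 s u v)
              + (v - u) ^ betaExp * hfun (K1 s u v)))
        = hfun s := by
  intro s hs
  change (∫ u in (0:ℝ)..1, ∫ v in u..(1:ℝ), F s u v) = hfun s
  rcases hs.1.eq_or_lt with h | h
  · subst h
    rw [hfun0, congr_oo (g := fun _ => 0) zero_le_one]
    · simp
    · intro u hu hu'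
      rw [congr_oo (g := fun _ => 0) hu'.le]
      · simp
      · intro v hv hv'
        have : ¬ (u ≤ 0 ∧ 0 < v) := by rintro ⟨h, -⟩; linarith
        simp [F, K0, K1, hu, this, hfun0]
  rcases hs.2.eq_or_lt with h' | h'
  · subst h'
    rw [hfun1, congr_oo (g := fun _ => 0) zero_le_one]
    · simp
    · intro u hu hu'
      rw [congr_oo (g := fun _ => 0) hu'.le]
      · simp
      · intro v hv hv'
        have h2 : ¬ (u ≤ 1 ∧ 1 < v) := by rintro ⟨-, h⟩; linarith
        have h3 : ¬ (1 < u) := by linarith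
        have h4 : ¬ (1 < v) := by linarith
        have h5 : 1 - (v - u) ≠ 0 := by linarith
        simp only [F, K0, K1, h2, h3, h4, if_false, div_self h5, hfun1]
        simp [hfun0]
  exact main_mid h h'

end
end

section
/- Let f, g : [0,1] → ℝ be bounded functions such that the quotient metric spaces X_f and X_g, obtained from the pseudometric spaces ([0,1], d_f) and ([0,1], d_g) by identifying points at distance zero, are compact. Then the Gromov–Hausdorff distance between X_f and X_g is at most 2·sup_{s∈[0,1]} |f(s) − g(s)|. -/
noncomputable section

/-- `d_f(x,y) = f(x) + f(y) − 2·inf{f(s) : x∧y ≤ s ≤ x∨y}`. -/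
def dPseudo (f : ℝ → ℝ) (x y : ℝ) : ℝ :=
  f x + f y - 2 * sInf (f '' Set.Icc (min x y) (max x y))

theorem aux_sInf_le (f g : ℝ → ℝ) (M C : ℝ) (S : Set ℝ) (hS : S.Nonempty)
    (hf : ∀ s ∈ S, |f s| ≤ C) (hM : ∀ s ∈ S, |f s - g s| ≤ M) :
    sInf (f '' S) - M ≤ sInf (g '' S) := by
  apply le_csInf (hS.image g)
  rintro _ ⟨s, hs, rfl⟩
  have h1 : sInf (f '' S) ≤ f s := by
    apply csInf_le
    · refine ⟨-C, ?_⟩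
      rintro _ ⟨t, ht, rfl⟩
      exact (abs_le.1 (hf t ht)).1
    · exact ⟨s, hs, rfl⟩
  have h2 := (abs_le.1 (hM s hs)).2
  linarith

theorem aux_dPseudo (f g : ℝ → ℝ) (M C C' : ℝ)
    (hf : ∀ s ∈ Set.Icc (0:ℝ) 1, |f s| ≤ C) (hg : ∀ s ∈ Set.Icc (0:ℝ) 1, |g s| ≤ C')
    (hM : ∀ s ∈ Set.Icc (0:ℝ) 1, |f s - g s| ≤ M)
    (x y : ℝ) (hx : x ∈ Set.Icc (0:ℝ) 1) (hy : y ∈ Set.Icc (0:ℝ) 1) :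
    |dPseudo f x y - dPseudo g x y| ≤ 4 * M := by
  have hsub : Set.Icc (min x y) (max x y) ⊆ Set.Icc (0:ℝ) 1 :=
    Set.Icc_subset_Icc (le_min hx.1 hy.1) (max_le hx.2 hy.2)
  have hne : (Set.Icc (min x y) (max x y)).Nonempty := Set.nonempty_Icc.2 min_le_max
  have h1 := aux_sInf_le f g M C _ hne (fun s hs => hf s (hsub hs)) (fun s hs => hM s (hsub hs))
  have h2 := aux_sInf_le g f M C' _ hne (fun s hs => hg s (hsub hs))
    (fun s hs => by rw [abs_sub_comm]; exact hM s (hsub hs))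
  have h3 := abs_le.1 (hM x hx)
  have h4 := abs_le.1 (hM y hy)
  unfold dPseudo
  rw [abs_le]
  constructor <;> linarith [h3.1, h3.2, h4.1, h4.2]

theorem aux_gh {Z X Y : Type} [MetricSpace X] [CompactSpace X] [Nonempty X]
    [MetricSpace Y] [CompactSpace Y] [Nonempty Y] [Nonempty Z]
    (p : Z → X) (q : Z → Y) (hp : Function.Surjective p) (hq : Function.Surjective q)
    (ε : ℝ) (ε0 : 0 < ε) (H : ∀ a b, |dist (p a) (p b) - dist (q a) (q b)| ≤ 2 * ε) :
    GromovHausdorff.ghDist X Y ≤ ε := by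
  let _ : MetricSpace (X ⊕ Y) := Metric.glueMetricApprox p q ε ε0 H
  have Il : Isometry (@Sum.inl X Y) := Isometry.of_dist_eq fun x y => rfl
  have Ir : Isometry (@Sum.inr X Y) := Isometry.of_dist_eq fun x y => rfl
  refine (GromovHausdorff.ghDist_le_hausdorffDist Il Ir).trans ?_
  refine Metric.hausdorffDist_le_of_mem_dist ε0.le ?_ ?_
  · rintro _ ⟨x, rfl⟩
    obtain ⟨z, rfl⟩ := hp x
    exact ⟨_, ⟨q z, rfl⟩, le_of_eq (Metric.glueDist_glued_points p q ε z)⟩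
  · rintro _ ⟨x, rfl⟩
    obtain ⟨z, rfl⟩ := hq x
    refine ⟨_, ⟨p z, rfl⟩, ?_⟩
    rw [dist_comm]
    exact le_of_eq (Metric.glueDist_glued_points p q ε z)

/-- if `X` and `Y` are the compact quotient metric spaces obtained from the
pseudometrics `d_f` and `d_g` on `[0,1]` by identifying points at distance zero (represented
here by compact metric spaces together with surjections from `[0,1]` carrying `d_f`, resp.
`d_g`, to the distance), then the Gromov–Hausdorff distance between `X` and `Y` is at most
`2·sup_{s∈[0,1]} |f(s) − g(s)|`. -/
theorem stmt_19 (f g : ℝ → ℝ)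
    (hf : ∃ M : ℝ, ∀ s ∈ Set.Icc (0:ℝ) 1, |f s| ≤ M)
    (hg : ∃ M : ℝ, ∀ s ∈ Set.Icc (0:ℝ) 1, |g s| ≤ M)
    (X : Type) [MetricSpace X] [CompactSpace X] [Nonempty X]
    (Y : Type) [MetricSpace Y] [CompactSpace Y] [Nonempty Y]
    (πf : Set.Icc (0:ℝ) 1 → X) (πg : Set.Icc (0:ℝ) 1 → Y)
    (hπf : Function.Surjective πf) (hπg : Function.Surjective πg)
    (hdf : ∀ x y : Set.Icc (0:ℝ) 1, dist (πf x) (πf y) = dPseudo f x y)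
    (hdg : ∀ x y : Set.Icc (0:ℝ) 1, dist (πg x) (πg y) = dPseudo g x y) :
    GromovHausdorff.ghDist X Y ≤ 2 * ⨆ s : Set.Icc (0:ℝ) 1, |f s - g s| := by
  obtain ⟨C, hC⟩ := hf
  obtain ⟨C', hC'⟩ := hg
  have hb : BddAbove (Set.range fun s : Set.Icc (0:ℝ) 1 => |f s - g s|) := by
    refine ⟨C + C', ?_⟩
    rintro _ ⟨s, rfl⟩
    exact (abs_sub _ _).trans (add_le_add (hC s s.2) (hC' s s.2))
  have hM : ∀ s ∈ Set.Icc (0:ℝ) 1, |f s - g s| ≤ ⨆ s : Set.Icc (0:ℝ) 1, |f s - g s| :=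
    fun s hs => le_ciSup hb ⟨s, hs⟩
  have hM0 : 0 ≤ ⨆ s : Set.Icc (0:ℝ) 1, |f s - g s| :=
    Real.iSup_nonneg fun _ => abs_nonneg _
  refine le_of_forall_pos_le_add fun δ δ0 => ?_
  refine aux_gh πf πg hπf hπg _ (by positivity) fun a b => ?_
  rw [hdf, hdg]
  have := aux_dPseudo f g _ C C' hC hC' hM a b a.2 b.2
  linarith

end
end
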